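/- arXiv:1504.01796 — 3 statements merged into one kernel-verified Lean document; each statement's English description precedes it below -/
import Mathlib

section
/- Uniform Fatou's Lemma: Let $(S,\Sigma)$ be a measurable space, $\{\mu^{(n)}\}$ finite measures converging in total variation to $\mu$, $f \in L^1(S;\mu)$, and $f^{(n)} \in L^1(S;\mu^{(n)})$ for each $n$. Then $\liminf_{n\to\infty}\inf_{A\in\Sigma}(\int_A f^{(n)}\,d\mu^{(n)} - \int_A f\,d\mu) \ge 0$ holds if and only if: (i) for each $\varepsilon>0$, $\mu(\{s: f^{(n)}(s) \le f(s)-\varepsilon\}) \to 0$ as $n\to\infty$; and (ii) $\liminf_{K\to+\infty}\inf_{n\ge 1}\int_S f^{(n)}\mathbf{1}\{f^{(n)} \le -K\}\,d\mu^{(n)} \ge 0$. -/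
open MeasureTheory Filter Topology

section Helpers

variable {S : Type*} [MeasurableSpace S]

/-- The integrals of a bounded function against two ordered finite measures differ by at most
the bound times the difference of the total masses. -/
lemma abs_integral_sub_le_of_measure_le {ρ σ : Measure S} [IsFiniteMeasure ρ] [IsFiniteMeasure σ]
    (hle : ρ ≤ σ) {h : S → ℝ} (hm : Measurable h) {M : ℝ} (hM : ∀ x, |h x| ≤ M) :
    |∫ x, h x ∂σ - ∫ x, h x ∂ρ| ≤ M * (σ.real Set.univ - ρ.real Set.univ) := by
  have hint : ∀ (τ : Measure S) [IsFiniteMeasure τ], Integrable h τ := fun τ _ =>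
    Integrable.of_bound hm.aestronglyMeasurable M (Eventually.of_forall hM)
  have h1 := integral_mono_measure hle
    (Eventually.of_forall fun x => by
      have := (abs_le.1 (hM x)).1
      simp only [Pi.zero_apply]
      linarith : 0 ≤ᵐ[σ] fun x => h x + M) ((hint σ).add (integrable_const M))
  have h2 := integral_mono_measure hle
    (Eventually.of_forall fun x => by
      have := (abs_le.1 (hM x)).2
      simp only [Pi.zero_apply]
      linarith : 0 ≤ᵐ[σ] fun x => M - h x) ((integrable_const M).sub (hint σ))
  rw [integral_add (hint ρ) (integrable_const M), integral_add (hint σ) (integrable_const M)] at h1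
  rw [integral_sub (integrable_const M) (hint ρ), integral_sub (integrable_const M) (hint σ)] at h2
  simp only [integral_const, smul_eq_mul] at h1 h2
  rw [abs_le]
  constructor <;> linarith

/-- If two finite measures differ by at most `δ` on every measurable set, the integrals over `A` of
a function bounded by `M` on `A` differ by at most `2 * M * δ`. -/
lemma abs_setIntegral_sub_le_of_bounded {μ ν : Measure S} [IsFiniteMeasure μ] [IsFiniteMeasure ν]
    {δ : ℝ} (hδ : ∀ A, MeasurableSet A → |ν.real A - μ.real A| ≤ δ)
    {h : S → ℝ} (hm : Measurable h) {A : Set S} (hA : MeasurableSet A) {M : ℝ} (hM0 : 0 ≤ M)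
    (hM : ∀ x ∈ A, |h x| ≤ M) :
    |∫ x in A, h x ∂ν - ∫ x in A, h x ∂μ| ≤ 2 * M * δ := by
  have hb : ∀ x, |A.indicator h x| ≤ M := by
    intro x
    by_cases hx : x ∈ A
    · simpa [hx] using hM x hx
    · simpa [hx] using hM0
  have hmi := hm.indicator hA
  have hint : ∀ (τ : Measure S) [IsFiniteMeasure τ], Integrable (A.indicator h) τ := fun τ _ =>
    Integrable.of_bound hmi.aestronglyMeasurable M (Eventually.of_forall hb)
  obtain ⟨s, hs⟩ := exists_isHahnDecomposition ν μ
  have hsm := hs.measurableSet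
  have h1 := abs_integral_sub_le_of_measure_le hs.le_on hmi hb
  have h2 := abs_integral_sub_le_of_measure_le hs.ge_on_compl hmi hb
  simp only [measureReal_restrict_apply MeasurableSet.univ, Set.univ_inter] at h1 h2
  rw [← integral_indicator hA, ← integral_indicator hA,
    ← integral_add_compl hsm (hint ν), ← integral_add_compl hsm (hint μ)]
  have h3 := mul_le_mul_of_nonneg_left (abs_le.1 (hδ s hsm)).1 hM0
  have h4 := mul_le_mul_of_nonneg_left (abs_le.1 (hδ sᶜ hsm.compl)).2 hM0
  rw [abs_le] at h1 h2 ⊢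
  constructor <;> linarith [h1.1, h1.2, h2.1, h2.2]

lemma exists_measureReal_lt_abs_lt {μ : Measure S} [IsFiniteMeasure μ] {g : S → ℝ}
    (hg : Integrable g μ) {η : ℝ} (hη : 0 < η) : ∃ M : ℝ, 0 ≤ M ∧ μ.real {x | M < |g x|} < η := by
  have hI : 0 ≤ ∫ x, |g x| ∂μ := integral_nonneg fun x => abs_nonneg _
  set M := (∫ x, |g x| ∂μ) / η + 1 with hMdef
  have hM : 0 < M := by positivity
  refine ⟨M, hM.le, ?_⟩
  have h1 := mul_meas_ge_le_integral_of_nonneg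
    (Eventually.of_forall fun x => abs_nonneg (g x)) hg.abs M
  have h2 : μ.real {x | M < |g x|} ≤ μ.real {x | M ≤ |g x|} :=
    measureReal_mono fun x (hx : M < |g x|) => (hx.le : M ≤ |g x|)
  refine h2.trans_lt (lt_of_mul_lt_mul_left (h1.trans_lt ?_) hM.le)
  have : M * η = (∫ x, |g x| ∂μ) + η := by rw [hMdef]; field_simp
  linarith

lemma exists_setIntegral_abs_lt {μ : Measure S} [IsFiniteMeasure μ] {g : S → ℝ}
    (hg : Integrable g μ) {ε : ℝ} (hε : 0 < ε) :
    ∃ η : ℝ, 0 < η ∧ ∀ A, μ.real A < η → ∫ x in A, |g x| ∂μ < ε := by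
  by_contra! hcon
  choose A hA hA' using fun n : ℕ => hcon (1 / ((n : ℝ) + 1)) (by positivity)
  have h0 : Tendsto (fun n => μ.real (A n)) atTop (𝓝 0) :=
    squeeze_zero (fun _ => measureReal_nonneg) (fun n => (hA n).le)
      tendsto_one_div_add_atTop_nhds_zero_nat
  have h1 : Tendsto (μ ∘ A) atTop (𝓝 0) :=
    (ENNReal.tendsto_toReal_iff (fun n => measure_ne_top μ _) ENNReal.zero_ne_top).1
      (by simpa [Measure.real] using h0)
  have h2 := hg.abs.tendsto_setIntegral_nhds_zero h1
  obtain ⟨n, hn⟩ := (h2.eventually_lt_const hε).exists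
  exact (hA' n).not_gt hn

lemma exists_forall_ge_neg_le_setIntegral {ν : Measure S} {G : S → ℝ} (hGm : Measurable G)
    (hG : Integrable G ν) {ε : ℝ} (hε : 0 < ε) :
    ∃ K₀ : ℝ, ∀ K ≥ K₀, -ε ≤ ∫ x in {x | G x ≤ -K}, G x ∂ν := by
  have h := tendsto_setIntegral_of_antitone (μ := ν) (f := G) (s := fun K : ℝ => {x | G x ≤ -K})
    (fun K => measurableSet_le hGm measurable_const)
    (fun K L hKL x (hx : G x ≤ -L) => (hx.trans (neg_le_neg hKL) : G x ≤ -K)) ⟨0, hG.integrableOn⟩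
  have he : ⋂ K : ℝ, {x | G x ≤ -K} = ∅ := by
    ext x
    simp only [Set.mem_iInter, Set.mem_ofPred_eq, Set.mem_empty_iff_false, iff_false, not_forall,
      not_le]
    exact ⟨-G x + 1, by linarith⟩
  rw [he, setIntegral_empty] at h
  obtain ⟨K₀, hK₀⟩ := eventually_atTop.1 (h.eventually_const_le (neg_lt_zero.2 hε))
  exact ⟨K₀, hK₀⟩

lemma abs_setIntegral_le_setIntegral_abs {μ : Measure S} {g : S → ℝ} (hg : Integrable g μ)
    {A B : Set S} (hAB : A ⊆ B) : |∫ x in A, g x ∂μ| ≤ ∫ x in B, |g x| ∂μ :=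
  (abs_integral_le_integral_abs).trans
    (setIntegral_mono_set hg.abs.integrableOn (Eventually.of_forall fun _ => abs_nonneg _)
      hAB.eventuallyLE)

variable {μs : ℕ → Measure S} {μ : Measure S} [∀ n, IsFiniteMeasure (μs n)] [IsFiniteMeasure μ]
  {δ : ℕ → ℝ} {f : S → ℝ} {F : ℕ → S → ℝ}

lemma tendsto_measureReal_of_uniform_fatou (hδ0 : Tendsto δ atTop (𝓝 0))
    (hδ : ∀ n A, MeasurableSet A → |(μs n).real A - μ.real A| ≤ δ n)
    (hfm : Measurable f) (hFm : ∀ n, Measurable (F n))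
    (hf : Integrable f μ) (hF : ∀ n, Integrable (F n) (μs n))
    (hU : ∀ ε : ℝ, 0 < ε → ∀ᶠ n in atTop, ∀ A, MeasurableSet A →
      -ε ≤ ∫ s in A, F n s ∂(μs n) - ∫ s in A, f s ∂μ) {ε η : ℝ} (hε : 0 < ε) (hη : 0 < η) :
    ∀ᶠ n in atTop, μ.real {s | F n s ≤ f s - ε} < η := by
  obtain ⟨M, hM0, hM⟩ := exists_measureReal_lt_abs_lt hf (half_pos hη)
  have hlim : Tendsto (fun n => (2 * M + ε) * δ n) atTop (𝓝 0) := by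
    simpa using hδ0.const_mul (2 * M + ε)
  filter_upwards [hU (ε * η / 4) (by positivity),
    hlim.eventually_lt_const (show (0 : ℝ) < ε * η / 4 by positivity)] with n hn hdn
  set B : Set S := {s | F n s ≤ f s - ε} with hB
  set E : Set S := {s | M < |f s|} with hE
  have hBm : MeasurableSet B := measurableSet_le (hFm n) (hfm.sub_const ε)
  have hEm : MeasurableSet E := measurableSet_lt measurable_const hfm.abs
  have hAm : MeasurableSet (B \ E) := hBm.diff hEm
  have hbd : ∀ x ∈ B \ E, |f x| ≤ M := fun x hx => not_lt.1 hx.2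
  have hfi : IntegrableOn f (B \ E) (μs n) :=
    Measure.integrableOn_of_bounded (M := M) (measure_ne_top _ _) hfm.aestronglyMeasurable
      ((ae_restrict_iff' hAm).2 (Eventually.of_forall hbd))
  have hmono : ∫ s in B \ E, F n s ∂(μs n) ≤ ∫ s in B \ E, (f s - ε) ∂(μs n) :=
    setIntegral_mono_on (hF n).integrableOn (hfi.sub (integrable_const ε)) hAm fun x hx => hx.1
  rw [integral_sub hfi (integrable_const ε), setIntegral_const, smul_eq_mul] at hmono
  have h1 := (abs_le.1 (abs_setIntegral_sub_le_of_bounded (hδ n) hfm hAm hM0 hbd)).2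
  have h2 := mul_le_mul_of_nonneg_left (abs_le.1 (hδ n _ hAm)).1 hε.le
  have h3 := hn _ hAm
  have h4 : ε * μ.real (B \ E) < ε * (η / 2) := by linarith
  have h5 := lt_of_mul_lt_mul_left h4 hε.le
  have h6 : μ.real B ≤ μ.real (B \ E) + μ.real E :=
    (measureReal_mono (by rw [Set.sdiff_union_self]; exact Set.subset_union_left)).trans
      (measureReal_union_le _ _)
  linarith

lemma neg_le_setIntegral_of_uniform_fatou (hδ0 : Tendsto δ atTop (𝓝 0))
    (hδ : ∀ n A, MeasurableSet A → |(μs n).real A - μ.real A| ≤ δ n)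
    (hFm : ∀ n, Measurable (F n))
    (hf : Integrable f μ) (hF : ∀ n, Integrable (F n) (μs n))
    (hU : ∀ ε : ℝ, 0 < ε → ∀ᶠ n in atTop, ∀ A, MeasurableSet A →
      -ε ≤ ∫ s in A, F n s ∂(μs n) - ∫ s in A, f s ∂μ) {ε : ℝ} (hε : 0 < ε) :
    ∃ K₀ : ℝ, ∀ K ≥ K₀, ∀ n, -ε ≤ ∫ s in {x | F n x ≤ -K}, F n s ∂(μs n) := by
  obtain ⟨η, hη, hηf⟩ := exists_setIntegral_abs_lt hf (half_pos hε)
  obtain ⟨N, hN⟩ := eventually_atTop.1 ((hU (ε / 2) (half_pos hε)).and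
    (hδ0.eventually_lt_const (half_pos hη)))
  choose k hk using fun n => exists_forall_ge_neg_le_setIntegral (hFm n) (hF n) hε
  set C : ℝ := ∫ s, |f s| ∂μ + ε / 2 with hC
  have hC0 : 0 < C := by
    have : 0 ≤ ∫ s, |f s| ∂μ := integral_nonneg fun _ => abs_nonneg _
    positivity
  obtain ⟨k', hk'⟩ := ((Finset.range N).image k).bddAbove
  refine ⟨max k' (2 * C / η + 1), fun K hK n => ?_⟩
  obtain ⟨hK1, hK2⟩ := max_le_iff.1 hK
  rcases lt_or_ge n N with hn | hn
  · exact hk n K ((hk' (by simpa using ⟨n, hn, rfl⟩)).trans hK1)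
  obtain ⟨hUn, hdn⟩ := hN n hn
  have hKpos : 0 < K := by
    have : 0 < 2 * C / η := by positivity
    linarith
  set A : Set S := {x | F n x ≤ -K} with hA
  have hAm : MeasurableSet A := measurableSet_le (hFm n) measurable_const
  have h1 := hUn A hAm
  have h2 := (abs_le.1 (abs_setIntegral_le_setIntegral_abs hf (Set.subset_univ A))).1
  rw [setIntegral_univ] at h2
  have h3 : ∫ s in A, F n s ∂(μs n) ≤ ∫ s in A, -K ∂(μs n) :=
    setIntegral_mono_on (hF n).integrableOn (integrable_const _) hAm fun x hx => hx
  rw [setIntegral_const, smul_eq_mul] at h3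
  have h4 : K * (μs n).real A ≤ C := by linarith
  have h5 : (μs n).real A < η / 2 := by
    refine lt_of_mul_lt_mul_left (h4.trans_lt ?_) hKpos.le
    have : (2 * C / η + 1) * (η / 2) ≤ K * (η / 2) := by gcongr
    have h6 : (2 * C / η + 1) * (η / 2) = C + η / 2 := by field_simp
    linarith
  have h6 : μ.real A < η := by linarith [(abs_le.1 (hδ n A hAm)).1]
  have h7 := (abs_le.1 (abs_setIntegral_le_setIntegral_abs hf subset_rfl (A := A))).1
  linarith [hηf A h6]

lemma uniform_fatou_of_tendsto_measureReal (hδ0 : Tendsto δ atTop (𝓝 0))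
    (hδ : ∀ n A, MeasurableSet A → |(μs n).real A - μ.real A| ≤ δ n)
    (hfm : Measurable f) (hFm : ∀ n, Measurable (F n))
    (hf : Integrable f μ) (hF : ∀ n, Integrable (F n) (μs n))
    (hi : ∀ ε η : ℝ, 0 < ε → 0 < η → ∀ᶠ n in atTop, μ.real {s | F n s ≤ f s - ε} < η)
    (hii : ∀ ε : ℝ, 0 < ε → ∃ K₀ : ℝ, ∀ K ≥ K₀, ∀ n,
      -ε ≤ ∫ s in {x | F n x ≤ -K}, F n s ∂(μs n)) {ε : ℝ} (hε : 0 < ε) :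
    ∀ᶠ n in atTop, ∀ A, MeasurableSet A →
      -ε ≤ ∫ s in A, F n s ∂(μs n) - ∫ s in A, f s ∂μ := by
  obtain ⟨K₀, hK₀⟩ := hii (ε / 8) (by positivity)
  set K := max K₀ 1 with hKdef
  have hK1 : 1 ≤ K := le_max_right _ _
  have hKpos : 0 < K := by linarith
  have hK := hK₀ K (le_max_left _ _)
  obtain ⟨η, hη, hηf⟩ := exists_setIntegral_abs_lt hf (ε := ε / 8) (by positivity)
  set θ : ℝ := min (η / 2) (ε / (16 * K)) with hθ
  have hθ0 : 0 < θ := lt_min (by positivity) (by positivity)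
  have hθη : θ ≤ η / 2 := min_le_left _ _
  have hθK : K * (2 * θ) ≤ ε / 8 := by
    calc K * (2 * θ) ≤ K * (2 * (ε / (16 * K))) := by gcongr; exact min_le_right _ _
      _ = ε / 8 := by field_simp; norm_num
  obtain ⟨M, hM0, hM⟩ := exists_measureReal_lt_abs_lt hf hθ0
  set m : ℝ := μ.real Set.univ with hm
  have hm0 : 0 ≤ m := measureReal_nonneg
  set γ : ℝ := ε / (8 * (m + 1)) with hγ
  have hγ0 : 0 < γ := by positivity
  have hγm : γ * (m + 1) = ε / 8 := by rw [hγ]; field_simp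
  have hlim : Tendsto (fun n => (2 * M + K) * δ n) atTop (𝓝 0) := by
    simpa using hδ0.const_mul (2 * M + K)
  filter_upwards [hi γ θ hγ0 hθ0, hlim.eventually_lt_const (show (0 : ℝ) < ε / 8 by positivity),
    hδ0.eventually_lt_const one_pos] with n hB hdn hdn1 A hAm
  have hd0 : 0 ≤ δ n := (abs_nonneg _).trans (hδ n ∅ MeasurableSet.empty)
  set B : Set S := {s | F n s ≤ f s - γ} with hBdef
  set E : Set S := {s | M < |f s|} with hE
  set D : Set S := {x | F n x ≤ -K} with hD
  have hBm : MeasurableSet B := measurableSet_le (hFm n) (hfm.sub_const γ)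
  have hEm : MeasurableSet E := measurableSet_lt measurable_const hfm.abs
  have hDm : MeasurableSet D := measurableSet_le (hFm n) measurable_const
  have hBEm : MeasurableSet (B ∪ E) := hBm.union hEm
  have hμBE : μ.real (B ∪ E) < 2 * θ := by linarith [measureReal_union_le (μ := μ) B E]
  have hGm : MeasurableSet (A \ (B ∪ E)) := hAm.diff hBEm
  have hbd : ∀ x ∈ A \ (B ∪ E), |f x| ≤ M := fun x hx => not_lt.1 fun h => hx.2 (Or.inr h)
  have hfi : IntegrableOn f (A \ (B ∪ E)) (μs n) :=
    Measure.integrableOn_of_bounded (M := M) (measure_ne_top _ _) hfm.aestronglyMeasurable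
      ((ae_restrict_iff' hGm).2 (Eventually.of_forall hbd))
  have hgood : ∫ s in A \ (B ∪ E), (f s - γ) ∂(μs n) ≤ ∫ s in A \ (B ∪ E), F n s ∂(μs n) :=
    setIntegral_mono_on (hfi.sub (integrable_const γ)) (hF n).integrableOn hGm
      fun x hx => le_of_not_ge fun h => hx.2 (Or.inl h)
  rw [integral_sub hfi (integrable_const γ), setIntegral_const, smul_eq_mul] at hgood
  have hmass : (μs n).real (A \ (B ∪ E)) * γ ≤ ε / 8 := by
    rw [← hγm, mul_comm]
    have h1 := (abs_le.1 (hδ n _ MeasurableSet.univ)).2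
    have h2 : (μs n).real (A \ (B ∪ E)) ≤ (μs n).real Set.univ :=
      measureReal_mono (Set.subset_univ _)
    exact mul_le_mul_of_nonneg_left (by linarith) hγ0.le
  have hcmp := (abs_le.1 (abs_setIntegral_sub_le_of_bounded (hδ n) hfm hGm hM0 hbd)).1
  have hbad : ∫ s in A ∩ (B ∪ E), (D.indicator (F n) s - K) ∂(μs n) ≤
      ∫ s in A ∩ (B ∪ E), F n s ∂(μs n) := by
    refine setIntegral_mono_on (((hF n).indicator hDm).integrableOn.sub (integrable_const K))
      (hF n).integrableOn (hAm.inter hBEm) fun x _ => ?_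
    by_cases hx : x ∈ D
    · rw [Set.indicator_of_mem hx]; linarith
    · rw [Set.indicator_of_notMem hx]
      have : -K < F n x := not_le.1 hx
      linarith
  rw [integral_sub ((hF n).indicator hDm).integrableOn (integrable_const K), setIntegral_const,
    smul_eq_mul] at hbad
  have htail : ∫ s in D, F n s ∂(μs n) ≤ ∫ s in A ∩ (B ∪ E), D.indicator (F n) s ∂(μs n) := by
    have hnp : ∀ x, D.indicator (F n) x ≤ 0 := fun x =>
      Set.indicator_nonpos (fun x (hx : F n x ≤ -K) => by linarith) x
    rw [← integral_indicator hDm, ← integral_indicator (hAm.inter hBEm)]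
    refine integral_mono ((hF n).indicator hDm)
      (((hF n).indicator hDm).indicator (hAm.inter hBEm)) fun x => ?_
    by_cases hx : x ∈ A ∩ (B ∪ E)
    · rw [Set.indicator_of_mem hx]
    · rw [Set.indicator_of_notMem hx]; exact hnp x
  have hbadmass : (μs n).real (A ∩ (B ∪ E)) * K ≤ ε / 8 + K * δ n := by
    have h1 := (abs_le.1 (hδ n _ hBEm)).2
    have h2 : (μs n).real (A ∩ (B ∪ E)) ≤ (μs n).real (B ∪ E) :=
      measureReal_mono Set.inter_subset_right
    have h3 : K * (μs n).real (A ∩ (B ∪ E)) ≤ K * (2 * θ + δ n) :=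
      mul_le_mul_of_nonneg_left (by linarith) hKpos.le
    linarith
  have hfbad := (abs_le.1 (abs_setIntegral_le_setIntegral_abs hf
    (Set.inter_subset_right (s := A) (t := B ∪ E)))).2
  have hfsmall := hηf (B ∪ E) (by linarith)
  have hKn := hK n
  rw [← integral_inter_add_sdiff hBEm (hF n).integrableOn,
    ← integral_inter_add_sdiff hBEm (hf.integrableOn (s := A))]
  linarith

lemma neg_le_iInf_measurableSet_iff {g : Set S → ℝ} {C ε : ℝ} (hg : ∀ A, |g A| ≤ C) (hε : 0 ≤ ε) :
    -ε ≤ ⨅ (A : Set S) (_ : MeasurableSet A), g A ↔ ∀ A, MeasurableSet A → -ε ≤ g A := by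
  have hC : 0 ≤ C := (abs_nonneg _).trans (hg ∅)
  have hbdd : BddBelow (Set.range fun A : Set S => ⨅ (_ : MeasurableSet A), g A) := by
    refine ⟨-C, ?_⟩
    rintro _ ⟨A, rfl⟩
    by_cases hA : MeasurableSet A
    · simpa [hA] using (abs_le.1 (hg A)).1
    · simpa [hA, Real.iInf_of_isEmpty] using hC
  constructor
  · intro h A hA
    simpa [hA] using h.trans (ciInf_le hbdd A)
  · intro h
    refine le_ciInf fun A => ?_
    by_cases hA : MeasurableSet A
    · simpa [hA] using h A hA
    · simpa [hA, Real.iInf_of_isEmpty] using hε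

lemma isFiniteMeasure_of_tendsto_iSup_sub {μs : ℕ → Measure S} {μ : Measure S}
    [∀ n, IsFiniteMeasure (μs n)]
    (htv : Tendsto (fun n => ⨆ (A : Set S) (_ : MeasurableSet A),
      (μs n A - μ A) + (μ A - μs n A)) atTop (𝓝 0)) : IsFiniteMeasure μ := by
  obtain ⟨n, hn⟩ := (htv.eventually_lt_const one_pos).exists
  refine ⟨lt_top_iff_ne_top.2 fun htop => ?_⟩
  have h1 : (μs n Set.univ - μ Set.univ) + (μ Set.univ - μs n Set.univ) < 1 :=
    (le_iSup₂ (f := fun (A : Set S) (_ : MeasurableSet A) =>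
      (μs n A - μ A) + (μ A - μs n A)) Set.univ MeasurableSet.univ).trans_lt hn
  simp [htop, ENNReal.top_sub (measure_ne_top (μs n) Set.univ)] at h1

lemma exists_abs_measureReal_sub_le_of_tendsto_iSup_sub
    (htv : Tendsto (fun n => ⨆ (A : Set S) (_ : MeasurableSet A),
      (μs n A - μ A) + (μ A - μs n A)) atTop (𝓝 0)) :
    ∃ δ : ℕ → ℝ, Tendsto δ atTop (𝓝 0) ∧
      ∀ n A, MeasurableSet A → |(μs n).real A - μ.real A| ≤ δ n := by
  set d : ℕ → ENNReal := fun n => ⨆ (A : Set S) (_ : MeasurableSet A),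
      (μs n A - μ A) + (μ A - μs n A) with hd
  have hfin : ∀ n, d n ≠ ⊤ := by
    intro n
    refine ne_top_of_le_ne_top (b := μs n Set.univ + μ Set.univ)
      (ENNReal.add_ne_top.2 ⟨measure_ne_top _ _, measure_ne_top _ _⟩) ?_
    exact iSup₂_le fun A _ => add_le_add
      (tsub_le_self.trans (measure_mono (Set.subset_univ A)))
      (tsub_le_self.trans (measure_mono (Set.subset_univ A)))
  refine ⟨fun n => (d n).toReal, ?_, fun n A hA => ?_⟩
  · simpa using (ENNReal.tendsto_toReal_iff hfin ENNReal.zero_ne_top).2 htv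
  have hle : (μs n A - μ A) + (μ A - μs n A) ≤ d n :=
    le_iSup₂ (f := fun (A : Set S) (_ : MeasurableSet A) =>
      (μs n A - μ A) + (μ A - μs n A)) A hA
  have h1 : μs n A ≤ d n + μ A := tsub_le_iff_right.1 (le_self_add.trans hle)
  have h2 : μ A ≤ d n + μs n A := tsub_le_iff_right.1 (le_add_self.trans hle)
  have h1' := ENNReal.toReal_mono (ENNReal.add_ne_top.2 ⟨hfin n, measure_ne_top _ _⟩) h1
  have h2' := ENNReal.toReal_mono (ENNReal.add_ne_top.2 ⟨hfin n, measure_ne_top _ _⟩) h2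
  rw [ENNReal.toReal_add (hfin n) (measure_ne_top _ _)] at h1' h2'
  simp only [Measure.real]
  rw [abs_le]
  constructor <;> linarith

/-- Replacing functions by almost everywhere equal ones, for two measures that differ by at most
`δ` on measurable sets, changes the measure of a sublevel set of the difference by at most `δ`. -/
lemma measureReal_le_sub_le_add_of_ae_eq {μ ν : Measure S} [IsFiniteMeasure μ] {δ : ℝ}
    (hδ : ∀ A, MeasurableSet A → |ν.real A - μ.real A| ≤ δ)
    {f g F G : S → ℝ} (hfg : f =ᵐ[μ] g) (hFG : F =ᵐ[ν] G) (ε : ℝ) :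
    μ.real {s | F s ≤ f s - ε} ≤ μ.real {s | G s ≤ g s - ε} + δ := by
  set N : Set S := toMeasurable ν {s | F s ≠ G s}
  have hνN : ν.real N = 0 := by
    have h : ν {s | F s ≠ G s} = 0 := hFG
    simp [Measure.real, N, measure_toMeasurable, h]
  have hN : μ.real N ≤ δ := by
    have := (abs_le.1 (hδ N (measurableSet_toMeasurable _ _))).1
    linarith
  have hf0 : μ.real {s | f s ≠ g s} = 0 := by
    have h : μ {s | f s ≠ g s} = 0 := hfg
    simp [Measure.real, h]
  have hsub : {s | F s ≤ f s - ε} ⊆ ({s | G s ≤ g s - ε} ∪ N) ∪ {s | f s ≠ g s} := by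
    intro s (hs : F s ≤ f s - ε)
    by_cases h1 : f s = g s
    · by_cases h2 : F s = G s
      · exact Or.inl (Or.inl (by rw [h1, h2] at hs; exact hs))
      · exact Or.inl (Or.inr (subset_toMeasurable _ _ h2))
    · exact Or.inr h1
  have h1 := (measureReal_mono (μ := μ) hsub).trans (measureReal_union_le _ _)
  have h2 := measureReal_union_le (μ := μ) {s | G s ≤ g s - ε} N
  linarith

lemma tendsto_measure_zero_iff_measureReal {μ : Measure S} [IsFiniteMeasure μ] {A : ℕ → Set S} :
    Tendsto (fun n => μ (A n)) atTop (𝓝 0) ↔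
      ∀ η : ℝ, 0 < η → ∀ᶠ n in atTop, μ.real (A n) < η := by
  rw [← ENNReal.tendsto_toReal_iff (fun n => measure_ne_top μ _) ENNReal.zero_ne_top,
    Metric.tendsto_nhds]
  simp [Measure.real]

end Helpers

/-- Uniform Fatou's Lemma: the uniform inequality (1.1) holds if and only if
conditions (i) and (ii) hold. -/
theorem uniform_fatou_stmt5 {S : Type*} [MeasurableSpace S]
    (μs : ℕ → Measure S) (μ : Measure S) [∀ n, IsFiniteMeasure (μs n)]
    (htv : Tendsto (fun n => ⨆ (A : Set S) (_ : MeasurableSet A),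
      (μs n A - μ A) + (μ A - μs n A)) atTop (𝓝 0))
    (f : S → ℝ) (F : ℕ → S → ℝ)
    (hf : Integrable f μ) (hF : ∀ n, Integrable (F n) (μs n)) :
    (∀ ε : ℝ, 0 < ε → ∀ᶠ n in atTop,
      -ε ≤ ⨅ (A : Set S) (_ : MeasurableSet A),
        (∫ s in A, F n s ∂(μs n) - ∫ s in A, f s ∂μ)) ↔
    ((∀ ε : ℝ, 0 < ε →
        Tendsto (fun n => μ {s | F n s ≤ f s - ε}) atTop (𝓝 0)) ∧
      (∀ ε : ℝ, 0 < ε → ∃ K₀ : ℝ, ∀ K ≥ K₀, ∀ n,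
        -ε ≤ ∫ s in {x | F n x ≤ -K}, F n s ∂(μs n))) := by
  have := isFiniteMeasure_of_tendsto_iSup_sub htv
  obtain ⟨δ, hδ0, hδ⟩ := exists_abs_measureReal_sub_le_of_tendsto_iSup_sub htv
  obtain ⟨g, hgm, hfg⟩ := hf.aestronglyMeasurable.aemeasurable
  choose G hGm hFG using fun n => (hF n).aestronglyMeasurable.aemeasurable
  have hg := hf.congr hfg
  have hG := fun n => (hF n).congr (hFG n)
  have hU : (∀ ε : ℝ, 0 < ε → ∀ᶠ n in atTop,
      -ε ≤ ⨅ (A : Set S) (_ : MeasurableSet A),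
        (∫ s in A, F n s ∂(μs n) - ∫ s in A, f s ∂μ)) ↔
      ∀ ε : ℝ, 0 < ε → ∀ᶠ n in atTop, ∀ A, MeasurableSet A →
        -ε ≤ ∫ s in A, G n s ∂(μs n) - ∫ s in A, g s ∂μ := by
    refine forall₂_congr fun ε hε => eventually_congr (Eventually.of_forall fun n => ?_)
    have hA : ∀ A : Set S, ∫ s in A, F n s ∂(μs n) - ∫ s in A, f s ∂μ =
        ∫ s in A, G n s ∂(μs n) - ∫ s in A, g s ∂μ := fun A => by
      rw [integral_congr_ae (ae_restrict_of_ae (hFG n)), integral_congr_ae (ae_restrict_of_ae hfg)]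
    simp only [hA]
    refine neg_le_iInf_measurableSet_iff
      (C := ∫ s, |G n s| ∂(μs n) + ∫ s, |g s| ∂μ) (fun A => ?_) hε.le
    have h1 := abs_setIntegral_le_setIntegral_abs (hG n) (Set.subset_univ A)
    have h2 := abs_setIntegral_le_setIntegral_abs hg (Set.subset_univ A)
    rw [setIntegral_univ] at h1 h2
    exact (abs_sub _ _).trans (add_le_add h1 h2)
  have hi : (∀ ε : ℝ, 0 < ε → Tendsto (fun n => μ {s | F n s ≤ f s - ε}) atTop (𝓝 0)) ↔
      ∀ ε η : ℝ, 0 < ε → 0 < η → ∀ᶠ n in atTop, μ.real {s | G n s ≤ g s - ε} < η := by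
    simp only [tendsto_measure_zero_iff_measureReal]
    constructor
    · intro h ε η hε hη
      filter_upwards [h ε hε _ (half_pos hη), hδ0.eventually_lt_const (half_pos hη)] with n h1 h2
      linarith [measureReal_le_sub_le_add_of_ae_eq (hδ n) hfg.symm (hFG n).symm ε]
    · intro h ε hε η hη
      filter_upwards [h ε _ hε (half_pos hη), hδ0.eventually_lt_const (half_pos hη)] with n h1 h2
      linarith [measureReal_le_sub_le_add_of_ae_eq (hδ n) hfg (hFG n) ε]
  have hii : ∀ (n : ℕ) (K : ℝ), ∫ s in {x | F n x ≤ -K}, F n s ∂(μs n) =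
      ∫ s in {x | G n x ≤ -K}, G n s ∂(μs n) := fun n K => by
    rw [integral_congr_ae (ae_restrict_of_ae (hFG n))]
    refine setIntegral_congr_set ?_
    filter_upwards [hFG n] with x hx
    exact congrArg (· ≤ -K) hx
  rw [hU, hi]
  simp only [hii]
  constructor
  · exact fun h => ⟨fun ε η hε hη =>
        tendsto_measureReal_of_uniform_fatou hδ0 hδ hgm hGm hg hG h hε hη,
      fun ε hε => neg_le_setIntegral_of_uniform_fatou hδ0 hδ hGm hg hG h hε⟩
  · exact fun h ε hε => uniform_fatou_of_tendsto_measureReal hδ0 hδ hgm hGm hg hG h.1 h.2 hε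
end

section
/- Uniform dominated convergence theorem for variable measures: Let $(S,\Sigma)$ be a measurable space, $\{\mu^{(n)}\}$ finite measures converging in total variation to $\mu$, $f \in L^1(S;\mu)$, and $f^{(n)} \in L^1(S;\mu^{(n)})$. Then $\lim_{n\to\infty}\sup_{A\in\Sigma}|\int_A f^{(n)}\,d\mu^{(n)} - \int_A f\,d\mu| = 0$ if and only if: (i) $f^{(n)} \to f$ in measure $\mu$; and (ii) $\lim_{K\to+\infty}\sup_{n\ge1}\int_S |f^{(n)}|\mathbf{1}\{|f^{(n)}| \ge K\}\,d\mu^{(n)} = 0$. -/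
open MeasureTheory Filter Topology

namespace UniformFatou

/-- Truncation of a real number to `[-K, K]`. -/
def trunc (K x : ℝ) : ℝ := max (-K) (min K x)

theorem measurable_trunc (K : ℝ) : Measurable (trunc K) :=
  measurable_const.max (measurable_const.min measurable_id)

theorem abs_trunc_le {K : ℝ} (hK : 0 ≤ K) (x : ℝ) : |trunc K x| ≤ K := by
  grind [trunc]

theorem abs_trunc_sub_trunc_le (K x y : ℝ) : |trunc K x - trunc K y| ≤ |x - y| := by
  grind [trunc]

theorem abs_sub_trunc_le_indicator {S : Type*} {K : ℝ} (hK : 0 ≤ K) (f : S → ℝ) (s : S) :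
    |f s - trunc K (f s)| ≤ {s | K ≤ |f s|}.indicator (fun s => |f s|) s := by
  by_cases h : K ≤ |f s|
  · rw [Set.indicator_of_mem (show s ∈ {s | K ≤ |f s|} from h)]
    grind [trunc]
  · rw [Set.indicator_of_notMem (show s ∉ {s | K ≤ |f s|} from h)]
    grind [trunc]

variable {S : Type*} [MeasurableSpace S]

theorem integral_le_add_of_measureReal_le {μ ν : Measure S} [IsFiniteMeasure μ]
    [IsFiniteMeasure ν] {δ K : ℝ} (hK : 0 ≤ K)
    (hδ : ∀ A, MeasurableSet A → ν.real A ≤ μ.real A + δ) {g : S → ℝ} (hg : Measurable g)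
    (h0 : ∀ s, 0 ≤ g s) (hgK : ∀ s, g s ≤ K) :
    ∫ s, g s ∂ν ≤ ∫ s, g s ∂μ + K * δ := by
  have hbd : ∀ s, ‖g s‖ ≤ K := fun s => by rw [Real.norm_of_nonneg (h0 s)]; exact hgK s
  have hint : ∀ (ρ : Measure S) [IsFiniteMeasure ρ], Integrable g ρ := fun ρ _ =>
    .of_bound hg.aestronglyMeasurable K (.of_forall hbd)
  have hanti : ∀ (ρ : Measure S) [IsFiniteMeasure ρ],
      IntegrableOn (fun t => ρ.real {a | t ≤ g a}) (Set.Ioc 0 K) := fun ρ _ => by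
    have : Antitone fun t => ρ.real {a | t ≤ g a} := fun t u htu =>
      measureReal_mono fun a (ha : u ≤ g a) => htu.trans ha
    exact ((this.antitoneOn _).integrableOn_isCompact isCompact_Icc).mono_set
      Set.Ioc_subset_Icc_self
  rw [(hint ν).integral_eq_integral_Ioc_meas_le (.of_forall h0) (.of_forall hgK),
    (hint μ).integral_eq_integral_Ioc_meas_le (.of_forall h0) (.of_forall hgK)]
  have hc : ∫ _ in Set.Ioc 0 K, δ = K * δ := by simp [hK]
  rw [← hc, ← integral_add (hanti μ) (integrable_const _)]
  exact integral_mono (hanti ν) ((hanti μ).add (integrable_const _))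
    fun t => hδ _ (measurableSet_le measurable_const hg)

theorem abs_integral_sub_le {μ ν : Measure S} [IsFiniteMeasure μ]
    [IsFiniteMeasure ν] {δ K : ℝ} (hK : 0 ≤ K)
    (hδ : ∀ A, MeasurableSet A → |ν.real A - μ.real A| ≤ δ) {g : S → ℝ} (hg : Measurable g)
    (hgK : ∀ s, |g s| ≤ K) :
    |∫ s, g s ∂ν - ∫ s, g s ∂μ| ≤ 3 * K * δ := by
  have hint : ∀ (ρ : Measure S) [IsFiniteMeasure ρ], Integrable g ρ := fun ρ _ =>
    .of_bound hg.aestronglyMeasurable K (.of_forall hgK)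
  have hshift : ∀ (ρ : Measure S) [IsFiniteMeasure ρ],
      ∫ s, (g s + K) ∂ρ = ∫ s, g s ∂ρ + ρ.real Set.univ * K := fun ρ _ => by
    rw [integral_add (hint ρ) (integrable_const _)]; simp
  have h0 : ∀ s, 0 ≤ g s + K := fun s => by linarith [abs_le.1 (hgK s)]
  have h2 : ∀ s, g s + K ≤ 2 * K := fun s => by linarith [abs_le.1 (hgK s)]
  have h₁ := integral_le_add_of_measureReal_le (μ := μ) (ν := ν) (δ := δ) (by positivity)
    (fun A hA => by linarith [abs_le.1 (hδ A hA)]) (hg.add_const K) h0 h2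
  have h₂ := integral_le_add_of_measureReal_le (μ := ν) (ν := μ) (δ := δ) (by positivity)
    (fun A hA => by linarith [abs_le.1 (hδ A hA)]) (hg.add_const K) h0 h2
  rw [hshift, hshift] at h₁ h₂
  have h₃ := abs_le.1 (hδ _ MeasurableSet.univ)
  rw [abs_le]
  constructor <;> nlinarith

theorem abs_setIntegral_sub_le {μ ν : Measure S} [IsFiniteMeasure μ]
    [IsFiniteMeasure ν] {δ K : ℝ} (hK : 0 ≤ K)
    (hδ : ∀ A, MeasurableSet A → |ν.real A - μ.real A| ≤ δ) {g : S → ℝ} (hg : Measurable g)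
    {A : Set S} (hA : MeasurableSet A) (hgK : ∀ s ∈ A, |g s| ≤ K) :
    |∫ s in A, g s ∂ν - ∫ s in A, g s ∂μ| ≤ 3 * K * δ := by
  rw [← integral_indicator hA, ← integral_indicator hA]
  refine abs_integral_sub_le hK hδ (hg.indicator hA) fun s => ?_
  by_cases hs : s ∈ A <;> simp [hs, hgK, hK]

theorem mul_measureReal_le_of_add_le {μ ν : Measure S} [IsFiniteMeasure μ]
    [IsFiniteMeasure ν] {δ η M ε : ℝ} (hM : 0 ≤ M)
    (hδ : ∀ A, MeasurableSet A → |ν.real A - μ.real A| ≤ δ) {f F : S → ℝ} (hf : Measurable f)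
    (hF : Integrable F ν)
    (hη : ∀ A, MeasurableSet A → |∫ s in A, F s ∂ν - ∫ s in A, f s ∂μ| ≤ η)
    {A : Set S} (hA : MeasurableSet A) (hAM : ∀ s ∈ A, |f s| ≤ M)
    (hAε : ∀ s ∈ A, f s + ε ≤ F s) : ε * ν.real A ≤ η + 3 * M * δ := by
  have h₁ := abs_le.1 (hη A hA)
  have h₂ := abs_le.1 (abs_setIntegral_sub_le hM hδ hf hA hAM)
  have hfi : IntegrableOn f A ν :=
    .of_bound (measure_lt_top _ _) hf.aestronglyMeasurable M
      ((ae_restrict_iff' hA).2 (.of_forall hAM))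
  have hc : IntegrableOn (fun _ => ε) A ν := integrable_const _
  have h₃ := setIntegral_mono_on (hfi.add hc) hF.integrableOn hA hAε
  simp only [Pi.add_apply] at h₃
  rw [integral_add hfi hc, setIntegral_const, smul_eq_mul] at h₃
  linarith

theorem measureReal_le_abs_sub_le {μ ν : Measure S} [IsFiniteMeasure μ]
    [IsFiniteMeasure ν] {δ η M ε : ℝ} (hM : 0 ≤ M) (hε : 0 < ε)
    (hδ : ∀ A, MeasurableSet A → |ν.real A - μ.real A| ≤ δ) {f F : S → ℝ} (hf : Measurable f)
    (hFm : Measurable F) (hF : Integrable F ν)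
    (hη : ∀ A, MeasurableSet A → |∫ s in A, F s ∂ν - ∫ s in A, f s ∂μ| ≤ η) :
    μ.real {s | ε ≤ |F s - f s|} ≤
      μ.real {s | M ≤ |f s|} + 2 * ((η + 3 * M * δ) / ε + δ) := by
  set P := {s | f s + ε ≤ F s ∧ |f s| ≤ M}
  set N := {s | -f s + ε ≤ -F s ∧ |f s| ≤ M}
  have hb : MeasurableSet {s | |f s| ≤ M} := measurableSet_le hf.abs measurable_const
  have hP : MeasurableSet P := (measurableSet_le (hf.add_const ε) hFm).inter hb
  have hN : MeasurableSet N := (measurableSet_le (hf.neg.add_const ε) hFm.neg).inter hb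
  have h₁ := mul_measureReal_le_of_add_le hM hδ hf hF hη hP (fun s hs => hs.2) fun s hs => hs.1
  have h₂ := mul_measureReal_le_of_add_le (f := fun s => -f s) (F := fun s => -F s) hM hδ hf.neg
    hF.neg (fun A hA => by
      rw [integral_neg, integral_neg, neg_sub_neg, abs_sub_comm]; exact hη A hA) hN
    (fun s hs => by rw [abs_neg]; exact hs.2) fun s hs => hs.1
  rw [mul_comm, ← le_div_iff₀ hε] at h₁ h₂
  have hsub : {s | ε ≤ |F s - f s|} ⊆ {s | M ≤ |f s|} ∪ (P ∪ N) := by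
    intro s (hs : ε ≤ |F s - f s|)
    rcases le_total M |f s| with h | h
    · exact Or.inl h
    · rcases le_abs.1 hs with h' | h'
      · exact Or.inr (Or.inl ⟨by linarith, h⟩)
      · exact Or.inr (Or.inr ⟨by linarith, h⟩)
  have h₃ := (measureReal_mono (μ := μ) hsub).trans (measureReal_union_le _ _)
  have h₄ := measureReal_union_le (μ := μ) P N
  linarith [abs_le.1 (hδ P hP), abs_le.1 (hδ N hN)]

theorem setIntegral_abs_le {μ ν : Measure S} {η : ℝ} {f F : S → ℝ} (hf : Integrable f μ)
    (hFm : Measurable F) (hF : Integrable F ν)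
    (hη : ∀ A, MeasurableSet A → |∫ s in A, F s ∂ν - ∫ s in A, f s ∂μ| ≤ η)
    {B : Set S} (hB : MeasurableSet B) :
    ∫ s in B, |F s| ∂ν ≤ ∫ s in B, |f s| ∂μ + 2 * η := by
  have hP : MeasurableSet {s | 0 ≤ F s} := measurableSet_le measurable_const hFm
  have hBP := hB.inter hP
  have hBN := hB.diff hP
  rw [← integral_inter_add_sdiff hP hF.abs.integrableOn,
    ← integral_inter_add_sdiff hP hf.abs.integrableOn,
    setIntegral_congr_fun (g := F) hBP fun s hs => abs_of_nonneg hs.2,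
    setIntegral_congr_fun (g := fun s => -F s) hBN
      fun s hs => abs_of_nonpos (not_le.1 hs.2).le, integral_neg]
  have h₁ := setIntegral_mono hf.integrableOn hf.abs.integrableOn
    (s := B ∩ {s | 0 ≤ F s}) fun s => le_abs_self (f s)
  have h₂ := setIntegral_mono hf.neg.integrableOn hf.abs.integrableOn
    (s := B \ {s | 0 ≤ F s}) fun s => neg_le_abs (f s)
  simp only [Pi.neg_apply] at h₂
  rw [integral_neg] at h₂
  linarith [abs_le.1 (hη _ hBP), abs_le.1 (hη _ hBN)]

theorem setIntegral_abs_le_mul_add {μ : Measure S} [IsFiniteMeasure μ] {f : S → ℝ} {M : ℝ}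
    (hM : 0 ≤ M) (hfm : Measurable f) (hf : Integrable f μ) {B : Set S} (hB : MeasurableSet B) :
    ∫ s in B, |f s| ∂μ ≤ M * μ.real B + ∫ s in {s | M ≤ |f s|}, |f s| ∂μ := by
  have hT : MeasurableSet {s | M ≤ |f s|} := measurableSet_le measurable_const hfm.abs
  rw [← integral_inter_add_sdiff hT hf.abs.integrableOn]
  have h₁ := setIntegral_mono_set (s := B ∩ {s | M ≤ |f s|}) hf.abs.integrableOn
    (.of_forall fun s => abs_nonneg (f s)) (Set.inter_subset_right.eventuallyLE)
  have h₂ : ∫ s in B \ {s | M ≤ |f s|}, |f s| ∂μ ≤ ∫ _ in B \ {s | M ≤ |f s|}, M ∂μ :=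
    setIntegral_mono_on hf.abs.integrableOn (integrable_const _) (hB.diff hT)
      fun s hs => (not_le.1 hs.2).le
  rw [setIntegral_const, smul_eq_mul] at h₂
  have h₃ := mul_le_mul_of_nonneg_left
    (measureReal_mono (μ := μ) (Set.sdiff_subset (s := B) (t := {s | M ≤ |f s|}))) hM
  linarith

theorem tendsto_setIntegral_abs_tail {μ : Measure S} {f : S → ℝ}
    (hfm : Measurable f) (hf : Integrable f μ) :
    Tendsto (fun K : ℝ => ∫ s in {s | K ≤ |f s|}, |f s| ∂μ) atTop (𝓝 0) := by
  have hT : ∀ K : ℝ, MeasurableSet {s | K ≤ |f s|} := fun K =>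
    measurableSet_le measurable_const hfm.abs
  simp_rw [← fun K => integral_indicator (μ := μ) (f := fun s => |f s|) (hT K)]
  rw [← integral_zero S ℝ (μ := μ)]
  refine tendsto_integral_filter_of_dominated_convergence (fun s => |f s|)
    (.of_forall fun K => (hfm.abs.indicator (hT K)).aestronglyMeasurable)
    (.of_forall fun K => .of_forall fun s => ?_) hf.abs (.of_forall fun s => ?_)
  · simpa using norm_indicator_le_norm_self (fun s => |f s|) s
  · refine tendsto_const_nhds.congr' ?_
    filter_upwards [eventually_gt_atTop |f s|] with K hK
    exact (Set.indicator_of_notMem (by simpa using hK) _).symm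

theorem measureReal_le_setIntegral_abs_tail {μ : Measure S} [IsFiniteMeasure μ] {f : S → ℝ}
    {M : ℝ} (hM : 1 ≤ M) (hfm : Measurable f) (hf : Integrable f μ) :
    μ.real {s | M ≤ |f s|} ≤ ∫ s in {s | M ≤ |f s|}, |f s| ∂μ := by
  have h := setIntegral_mono_on (μ := μ) (f := fun _ => (1 : ℝ)) (s := {s | M ≤ |f s|})
    (integrable_const _) hf.abs.integrableOn (measurableSet_le measurable_const hfm.abs)
    fun s hs => hM.trans hs
  simpa using h

theorem tendsto_measureReal_abs_tail {μ : Measure S} [IsFiniteMeasure μ] {f : S → ℝ}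
    (hfm : Measurable f) (hf : Integrable f μ) :
    Tendsto (fun K : ℝ => μ.real {s | K ≤ |f s|}) atTop (𝓝 0) :=
  squeeze_zero' (.of_forall fun _ => measureReal_nonneg)
    ((eventually_ge_atTop 1).mono fun _ hM => measureReal_le_setIntegral_abs_tail hM hfm hf)
    (tendsto_setIntegral_abs_tail hfm hf)

theorem abs_setIntegral_sub_trunc_le {μ : Measure S} [IsFiniteMeasure μ] {f : S → ℝ} {K : ℝ}
    (hK : 0 ≤ K) (hfm : Measurable f) (hf : Integrable f μ) (A : Set S) :
    |∫ s in A, f s ∂μ - ∫ s in A, trunc K (f s) ∂μ| ≤ ∫ s in {s | K ≤ |f s|}, |f s| ∂μ := by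
  have hT : MeasurableSet {s | K ≤ |f s|} := measurableSet_le measurable_const hfm.abs
  have hti : Integrable (fun s => trunc K (f s)) μ :=
    .of_bound ((measurable_trunc K).comp hfm).aestronglyMeasurable K
      (.of_forall fun s => abs_trunc_le hK _)
  have hi : Integrable ({s | K ≤ |f s|}.indicator fun s => |f s|) μ := hf.abs.indicator hT
  rw [← integral_sub hf.integrableOn hti.integrableOn, ← integral_indicator hT]
  calc _ ≤ ∫ s in A, |f s - trunc K (f s)| ∂μ := abs_integral_le_integral_abs
    _ ≤ ∫ s in A, {s | K ≤ |f s|}.indicator (fun s => |f s|) s ∂μ :=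
      setIntegral_mono (hf.sub hti).abs.integrableOn hi.integrableOn
        (abs_sub_trunc_le_indicator hK f)
    _ ≤ _ := setIntegral_le_integral hi
      (.of_forall fun s => Set.indicator_nonneg (fun s _ => abs_nonneg (f s)) s)

theorem abs_setIntegral_trunc_sub_trunc_le {μ : Measure S} [IsFiniteMeasure μ] {f F : S → ℝ}
    {K ε : ℝ} (hK : 0 ≤ K) (hε : 0 ≤ ε) (hfm : Measurable f) (hFm : Measurable F) (A : Set S) :
    |∫ s in A, trunc K (F s) ∂μ - ∫ s in A, trunc K (f s) ∂μ| ≤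
      ε * μ.real Set.univ + 2 * K * μ.real {s | ε ≤ |F s - f s|} := by
  have hE : MeasurableSet {s | ε ≤ |F s - f s|} :=
    measurableSet_le measurable_const (hFm.sub hfm).abs
  have hti : ∀ g : S → ℝ, Measurable g → Integrable (fun s => trunc K (g s)) μ := fun g hg =>
    .of_bound ((measurable_trunc K).comp hg).aestronglyMeasurable K
      (.of_forall fun s => abs_trunc_le hK _)
  have hi : Integrable (fun s => {s | ε ≤ |F s - f s|}.indicator (fun _ => 2 * K) s) μ :=
    (integrable_const _).indicator hE
  have hbound : Integrable (fun s => ε + {s | ε ≤ |F s - f s|}.indicator (fun _ => 2 * K) s) μ :=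
    (integrable_const _).add hi
  rw [← integral_sub (hti F hFm).integrableOn (hti f hfm).integrableOn]
  calc _ ≤ ∫ s in A, |trunc K (F s) - trunc K (f s)| ∂μ := abs_integral_le_integral_abs
    _ ≤ ∫ s, |trunc K (F s) - trunc K (f s)| ∂μ :=
      setIntegral_le_integral ((hti F hFm).sub (hti f hfm)).abs
        (.of_forall fun s => abs_nonneg _)
    _ ≤ ∫ s, (ε + {s | ε ≤ |F s - f s|}.indicator (fun _ => 2 * K) s) ∂μ := by
      refine integral_mono ((hti F hFm).sub (hti f hfm)).abs hbound fun s => ?_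
      by_cases h : ε ≤ |F s - f s|
      · simp only [Set.indicator_of_mem (show s ∈ {s | ε ≤ |F s - f s|} from h)]
        have h₁ := abs_le.1 (abs_trunc_le hK (F s))
        have h₂ := abs_le.1 (abs_trunc_le hK (f s))
        exact abs_le.2 ⟨by linarith, by linarith⟩
      · simp only [Set.indicator_of_notMem (show s ∉ {s | ε ≤ |F s - f s|} from h), add_zero]
        exact (abs_trunc_sub_trunc_le K _ _).trans (not_le.1 h).le
    _ = _ := by
      rw [integral_add (integrable_const _) hi, integral_indicator hE, setIntegral_const,
        integral_const, smul_eq_mul, smul_eq_mul]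
      ring

theorem abs_setIntegral_sub_setIntegral_le {μ ν : Measure S} [IsFiniteMeasure μ]
    [IsFiniteMeasure ν] {δ K ε : ℝ} (hK : 0 ≤ K) (hε : 0 ≤ ε)
    (hδ : ∀ A, MeasurableSet A → |ν.real A - μ.real A| ≤ δ) {f F : S → ℝ} (hfm : Measurable f)
    (hf : Integrable f μ) (hFm : Measurable F) (hF : Integrable F ν) {A : Set S}
    (hA : MeasurableSet A) :
    |∫ s in A, F s ∂ν - ∫ s in A, f s ∂μ| ≤
      ∫ s in {s | K ≤ |F s|}, |F s| ∂ν + ∫ s in {s | K ≤ |f s|}, |f s| ∂μ + 3 * K * δ +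
        (ε * μ.real Set.univ + 2 * K * μ.real {s | ε ≤ |F s - f s|}) := by
  have h₁ := abs_le.1 (abs_setIntegral_sub_trunc_le hK hFm hF A)
  have h₂ := abs_le.1 (abs_setIntegral_sub_trunc_le hK hfm hf A)
  have h₃ := abs_le.1 (abs_setIntegral_sub_le hK hδ ((measurable_trunc K).comp hFm) hA
    fun s _ => abs_trunc_le hK _)
  have h₄ := abs_le.1 (abs_setIntegral_trunc_sub_trunc_le (μ := μ) hK hε hfm hFm A)
  simp only [Function.comp_apply] at h₃
  exact abs_le.2 ⟨by linarith, by linarith⟩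

theorem tendsto_measureReal_of_uniform {μs : ℕ → Measure S} {μ : Measure S}
    [∀ n, IsFiniteMeasure (μs n)] [IsFiniteMeasure μ]
    (hδ : ∀ δ > 0, ∀ᶠ n in atTop, ∀ A, MeasurableSet A → |(μs n).real A - μ.real A| ≤ δ)
    {f : S → ℝ} {F : ℕ → S → ℝ} (hfm : Measurable f) (hf : Integrable f μ)
    (hFm : ∀ n, Measurable (F n)) (hF : ∀ n, Integrable (F n) (μs n))
    (hη : ∀ η > 0, ∀ᶠ n in atTop, ∀ A, MeasurableSet A →
      |∫ s in A, F n s ∂(μs n) - ∫ s in A, f s ∂μ| ≤ η) {ε : ℝ} (hε : 0 < ε) :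
    Tendsto (fun n => μ.real {s | ε ≤ |F n s - f s|}) atTop (𝓝 0) := by
  refine tendsto_order.2 ⟨fun a ha => .of_forall fun n => ha.trans_le measureReal_nonneg,
    fun a ha => ?_⟩
  obtain ⟨M, hM, hM0⟩ := (((tendsto_measureReal_abs_tail hfm hf).eventually_lt_const
    (half_pos ha)).and (eventually_ge_atTop 0)).exists
  have hlim : Tendsto (fun δ : ℝ => 2 * ((δ + 3 * M * δ) / ε + δ)) (𝓝[>] 0) (𝓝 0) := by
    refine Tendsto.mono_left ?_ nhdsWithin_le_nhds
    have : Continuous fun δ : ℝ => 2 * ((δ + 3 * M * δ) / ε + δ) := by fun_prop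
    simpa using this.tendsto 0
  obtain ⟨δ, hδa, hδ0⟩ :=
    ((hlim.eventually_lt_const (half_pos ha)).and self_mem_nhdsWithin).exists
  filter_upwards [hδ δ hδ0, hη δ hδ0] with n h₁ h₂
  linarith [measureReal_le_abs_sub_le hM0 hε h₁ hfm (hFm n) (hF n) h₂]

theorem eventually_setIntegral_abs_tail_le_of_uniform {μs : ℕ → Measure S} {μ : Measure S}
    [IsFiniteMeasure μ] {f : S → ℝ} {F : ℕ → S → ℝ} (hfm : Measurable f) (hf : Integrable f μ)
    (hFm : ∀ n, Measurable (F n)) (hF : ∀ n, Integrable (F n) (μs n))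
    (hη : ∀ η > 0, ∀ᶠ n in atTop, ∀ A, MeasurableSet A →
      |∫ s in A, F n s ∂(μs n) - ∫ s in A, f s ∂μ| ≤ η)
    (hmeas : Tendsto (fun n => μ.real {s | 1 ≤ |F n s - f s|}) atTop (𝓝 0))
    {ε : ℝ} (hε : 0 < ε) :
    ∀ᶠ K : ℝ in atTop, ∀ n, ∫ s in {s | K ≤ |F n s|}, |F n s| ∂(μs n) ≤ ε := by
  obtain ⟨M, hM, hM0⟩ := (((tendsto_setIntegral_abs_tail hfm hf).eventually_lt_const
    (show 0 < ε / 4 by positivity)).and (eventually_gt_atTop 0)).exists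
  have hδ : 0 < ε / (8 * M) := by positivity
  obtain ⟨N, hN⟩ := eventually_atTop.1
    ((hη (ε / 8) (by positivity)).and (hmeas.eventually_lt_const hδ))
  have hfin : ∀ᶠ K : ℝ in atTop, ∀ n ∈ Set.Iio N,
      ∫ s in {s | K ≤ |F n s|}, |F n s| ∂(μs n) ≤ ε :=
    (eventually_all_finite (Set.finite_Iio N)).2 fun n _ =>
      (tendsto_setIntegral_abs_tail (hFm n) (hF n)).eventually_le_const hε
  have hshift := (tendsto_atTop_add_const_right atTop (-1 : ℝ) tendsto_id).eventually
    ((tendsto_measureReal_abs_tail hfm hf).eventually_lt_const hδ)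
  filter_upwards [hfin, hshift] with K hK₁ hK₂ n
  rcases lt_or_ge n N with hn | hn
  · exact hK₁ n hn
  obtain ⟨h₁, h₂⟩ := hN n hn
  have hB : MeasurableSet {s | K ≤ |F n s|} := measurableSet_le measurable_const (hFm n).abs
  have h₃ := setIntegral_abs_le hf (hFm n) (hF n) h₁ hB
  have h₄ := setIntegral_abs_le_mul_add hM0.le hfm hf hB
  have hsub : {s | K ≤ |F n s|} ⊆ {s | id K + -1 ≤ |f s|} ∪ {s | 1 ≤ |F n s - f s|} := by
    intro s (hs : K ≤ |F n s|)
    by_contra! h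
    simp only [Set.mem_union, Set.mem_ofPred_eq, not_or, not_le, id] at h
    have := abs_sub_abs_le_abs_sub (F n s) (f s)
    linarith
  have h₅ := (measureReal_mono (μ := μ) hsub).trans (measureReal_union_le _ _)
  have h₆ : M * μ.real {s | K ≤ |F n s|} ≤ M * (ε / (8 * M) + ε / (8 * M)) :=
    mul_le_mul_of_nonneg_left (by linarith) hM0.le
  have h₇ : M * (ε / (8 * M) + ε / (8 * M)) = ε / 4 := by field_simp; norm_num
  linarith

theorem eventually_abs_setIntegral_sub_le {μs : ℕ → Measure S} {μ : Measure S}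
    [∀ n, IsFiniteMeasure (μs n)] [IsFiniteMeasure μ]
    (hδ : ∀ δ > 0, ∀ᶠ n in atTop, ∀ A, MeasurableSet A → |(μs n).real A - μ.real A| ≤ δ)
    {f : S → ℝ} {F : ℕ → S → ℝ} (hfm : Measurable f) (hf : Integrable f μ)
    (hFm : ∀ n, Measurable (F n)) (hF : ∀ n, Integrable (F n) (μs n))
    (hmeas : ∀ ε : ℝ, 0 < ε →
      Tendsto (fun n => μ.real {s | ε ≤ |F n s - f s|}) atTop (𝓝 0))
    (hui : ∀ ε : ℝ, 0 < ε →
      ∀ᶠ K : ℝ in atTop, ∀ n, ∫ s in {s | K ≤ |F n s|}, |F n s| ∂(μs n) ≤ ε)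
    {η : ℝ} (hη : 0 < η) :
    ∀ᶠ n in atTop, ∀ A, MeasurableSet A →
      |∫ s in A, F n s ∂(μs n) - ∫ s in A, f s ∂μ| ≤ η := by
  have hη5 : 0 < η / 5 := by positivity
  obtain ⟨K, ⟨hK₁, hK₂⟩, hK0⟩ := (((hui _ hη5).and
    ((tendsto_setIntegral_abs_tail hfm hf).eventually_lt_const hη5)).and
      (eventually_gt_atTop 0)).exists
  set m := μ.real Set.univ
  have hm : 0 ≤ m := measureReal_nonneg
  have hε : 0 < η / 5 / (m + 1) := by positivity
  filter_upwards [hδ (η / 5 / (3 * K)) (by positivity),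
    (hmeas _ hε).eventually_lt_const (show 0 < η / 5 / (2 * K) by positivity)] with n h₁ h₂ A hA
  have h₃ := abs_setIntegral_sub_setIntegral_le hK0.le hε.le h₁ hfm hf (hFm n) (hF n) hA
  have h₄ : 3 * K * (η / 5 / (3 * K)) = η / 5 := by field_simp
  have h₅ : η / 5 / (m + 1) * m ≤ η / 5 := by
    rw [div_mul_eq_mul_div, div_le_iff₀ (by positivity)]
    nlinarith
  have h₆ := (lt_div_iff₀' (show 0 < 2 * K by positivity)).1 h₂
  linarith [hK₁ n]

theorem tendsto_measure_abs_sub_congr {μ : Measure S} {f g : S → ℝ} {F G : ℕ → S → ℝ}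
    (hfg : f =ᵐ[μ] g) (hFG : Tendsto (fun n => μ {s | F n s ≠ G n s}) atTop (𝓝 0)) {ε : ℝ}
    (h : Tendsto (fun n => μ {s | ε ≤ |F n s - f s|}) atTop (𝓝 0)) :
    Tendsto (fun n => μ {s | ε ≤ |G n s - g s|}) atTop (𝓝 0) := by
  have hsum := h.add hFG
  rw [add_zero] at hsum
  refine tendsto_of_tendsto_of_tendsto_of_le_of_le tendsto_const_nhds hsum
    (fun _ => zero_le) fun n => ?_
  have hsub : {s | ε ≤ |G n s - g s|} ⊆
      ({s | ε ≤ |F n s - f s|} ∪ {s | F n s ≠ G n s}) ∪ {s | f s ≠ g s} := by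
    intro s (hs : ε ≤ |G n s - g s|)
    by_contra! hc
    simp only [Set.mem_union, Set.mem_ofPred_eq, not_or, not_not] at hc
    rw [hc.1.2, hc.2] at hc
    exact hc.1.1 hs
  calc _ ≤ _ := measure_mono hsub
    _ ≤ _ + μ {s | f s ≠ g s} := measure_union_le _ _
    _ = μ ({s | ε ≤ |F n s - f s|} ∪ {s | F n s ≠ G n s}) := by
      rw [show μ {s | f s ≠ g s} = 0 from hfg, add_zero]
    _ ≤ _ := measure_union_le _ _

theorem setIntegral_abs_tail_congr {μ : Measure S} {f g : S → ℝ} (hfg : f =ᵐ[μ] g) (K : ℝ) :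
    ∫ s in {s | K ≤ |f s|}, |f s| ∂μ = ∫ s in {s | K ≤ |g s|}, |g s| ∂μ := by
  have hset : ({s | K ≤ |f s|} : Set S) =ᵐ[μ] {s | K ≤ |g s|} := by
    filter_upwards [hfg] with s hs
    exact propext (by change K ≤ |f s| ↔ K ≤ |g s|; rw [hs])
  rw [setIntegral_congr_set hset]
  exact integral_congr_ae (ae_restrict_of_ae (hfg.fun_comp abs))

theorem isFiniteMeasure_of_tendsto {μs : ℕ → Measure S} {μ : Measure S}
    [∀ n, IsFiniteMeasure (μs n)]
    (htv : Tendsto (fun n => ⨆ (A : Set S) (_ : MeasurableSet A),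
      (μs n A - μ A) + (μ A - μs n A)) atTop (𝓝 0)) : IsFiniteMeasure μ := by
  obtain ⟨n, hn⟩ := (htv.eventually_lt_const one_pos).exists
  have h : μ Set.univ - μs n Set.univ ≤ 1 := le_add_self.trans
    ((le_iSup₂ (f := fun (A : Set S) (_ : MeasurableSet A) =>
      (μs n A - μ A) + (μ A - μs n A)) Set.univ .univ).trans hn.le)
  exact ⟨(tsub_le_iff_right.1 h).trans_lt (by simp [measure_lt_top])⟩

theorem eventually_abs_measureReal_sub_le {μs : ℕ → Measure S} {μ : Measure S}
    [∀ n, IsFiniteMeasure (μs n)] [IsFiniteMeasure μ]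
    (htv : Tendsto (fun n => ⨆ (A : Set S) (_ : MeasurableSet A),
      (μs n A - μ A) + (μ A - μs n A)) atTop (𝓝 0)) {δ : ℝ} (hδ : 0 < δ) :
    ∀ᶠ n in atTop, ∀ A, MeasurableSet A → |(μs n).real A - μ.real A| ≤ δ := by
  filter_upwards [htv.eventually_lt_const (ENNReal.ofReal_pos.2 hδ)] with n hn A hA
  have h := (le_iSup₂ (f := fun (A : Set S) (_ : MeasurableSet A) =>
      (μs n A - μ A) + (μ A - μs n A)) A hA).trans hn.le
  have key : ∀ (ρ σ : Measure S) [IsFiniteMeasure ρ] [IsFiniteMeasure σ],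
      ρ A - σ A ≤ ENNReal.ofReal δ → ρ.real A ≤ δ + σ.real A := fun ρ σ _ _ h => by
    have := ENNReal.toReal_mono (by finiteness) (tsub_le_iff_right.1 h)
    rwa [ENNReal.toReal_add (by finiteness) (by finiteness), ENNReal.toReal_ofReal hδ.le] at this
  have h₁ := key _ _ (le_self_add.trans h)
  have h₂ := key _ _ (le_add_self.trans h)
  exact abs_le.2 ⟨by linarith, by linarith⟩

theorem tendsto_measure_zero_of_null {μs : ℕ → Measure S} {μ : Measure S}
    (htv : Tendsto (fun n => ⨆ (A : Set S) (_ : MeasurableSet A),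
      (μs n A - μ A) + (μ A - μs n A)) atTop (𝓝 0)) {E : ℕ → Set S}
    (hE : ∀ n, μs n (E n) = 0) : Tendsto (fun n => μ (E n)) atTop (𝓝 0) := by
  refine tendsto_of_tendsto_of_tendsto_of_le_of_le tendsto_const_nhds htv
    (fun _ => zero_le) fun n => ?_
  refine (measure_mono (subset_toMeasurable (μs n) (E n))).trans ?_
  have h := le_iSup₂ (f := fun (A : Set S) (_ : MeasurableSet A) =>
      (μs n A - μ A) + (μ A - μs n A)) _ (measurableSet_toMeasurable (μs n) (E n))
  simpa [hE] using h

theorem tendsto_iSup_measurableSet_iff {u : ℕ → Set S → ℝ} (h0 : ∀ n A, 0 ≤ u n A)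
    (hb : ∀ n, ∃ C, ∀ A, u n A ≤ C) :
    Tendsto (fun n => ⨆ (A : Set S) (_ : MeasurableSet A), u n A) atTop (𝓝 0) ↔
      ∀ η > 0, ∀ᶠ n in atTop, ∀ A, MeasurableSet A → u n A ≤ η := by
  have hle : ∀ n A, MeasurableSet A → u n A ≤ ⨆ (A : Set S) (_ : MeasurableSet A), u n A := by
    intro n A hA
    obtain ⟨C, hC⟩ := hb n
    have hbdd : BddAbove (Set.range fun A : Set S => ⨆ _ : MeasurableSet A, u n A) :=
      ⟨C, by rintro _ ⟨A, rfl⟩; exact Real.iSup_le (fun _ => hC A) ((h0 n A).trans (hC A))⟩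
    have := le_ciSup hbdd A
    rwa [ciSup_pos hA] at this
  constructor
  · intro h η hη
    filter_upwards [h.eventually_le_const hη] with n hn A hA
    exact (hle n A hA).trans hn
  · intro h
    refine tendsto_order.2 ⟨fun a ha => .of_forall fun n =>
      ha.trans_le (Real.iSup_nonneg fun A => Real.iSup_nonneg fun _ => h0 n A), fun a ha => ?_⟩
    filter_upwards [h (a / 2) (half_pos ha)] with n hn
    exact (Real.iSup_le (fun A => Real.iSup_le (hn A) (half_pos ha).le)
      (half_pos ha).le).trans_lt (half_lt_self ha)

theorem abs_setIntegral_sub_setIntegral_le_add {μ ν : Measure S} {f F : S → ℝ}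
    (hf : Integrable f μ) (hF : Integrable F ν) (A : Set S) :
    |∫ s in A, F s ∂ν - ∫ s in A, f s ∂μ| ≤ ∫ s, |F s| ∂ν + ∫ s, |f s| ∂μ := by
  have key : ∀ (ρ : Measure S) (g : S → ℝ), Integrable g ρ →
      |∫ s in A, g s ∂ρ| ≤ ∫ s, |g s| ∂ρ := fun ρ g hg =>
    abs_integral_le_integral_abs.trans
      (setIntegral_le_integral hg.abs (.of_forall fun s => abs_nonneg (g s)))
  exact (abs_sub _ _).trans (add_le_add (key ν F hF) (key μ f hf))

theorem uniform_iff_of_measurable {μs : ℕ → Measure S} {μ : Measure S}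
    [∀ n, IsFiniteMeasure (μs n)] [IsFiniteMeasure μ]
    (hδ : ∀ δ > 0, ∀ᶠ n in atTop, ∀ A, MeasurableSet A → |(μs n).real A - μ.real A| ≤ δ)
    {f : S → ℝ} {F : ℕ → S → ℝ} (hfm : Measurable f) (hf : Integrable f μ)
    (hFm : ∀ n, Measurable (F n)) (hF : ∀ n, Integrable (F n) (μs n)) :
    (∀ η > 0, ∀ᶠ n in atTop, ∀ A, MeasurableSet A →
      |∫ s in A, F n s ∂(μs n) - ∫ s in A, f s ∂μ| ≤ η) ↔
    ((∀ ε : ℝ, 0 < ε → Tendsto (fun n => μ {s | ε ≤ |F n s - f s|}) atTop (𝓝 0)) ∧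
      ∀ ε : ℝ, 0 < ε →
        ∀ᶠ K : ℝ in atTop, ∀ n, ∫ s in {s | K ≤ |F n s|}, |F n s| ∂(μs n) ≤ ε) := by
  have hreal : ∀ ε : ℝ, Tendsto (fun n => μ {s | ε ≤ |F n s - f s|}) atTop (𝓝 0) ↔
      Tendsto (fun n => μ.real {s | ε ≤ |F n s - f s|}) atTop (𝓝 0) := fun ε =>
    (ENNReal.tendsto_toReal_zero_iff fun n => measure_ne_top _ _).symm
  simp only [hreal]
  constructor
  · intro h
    have hmeas := fun (ε : ℝ) (hε : 0 < ε) =>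
      tendsto_measureReal_of_uniform hδ hfm hf hFm hF h hε
    exact ⟨hmeas, fun ε hε => eventually_setIntegral_abs_tail_le_of_uniform hfm hf hFm hF h
      (hmeas 1 one_pos) hε⟩
  · rintro ⟨hmeas, hui⟩ η hη
    exact eventually_abs_setIntegral_sub_le hδ hfm hf hFm hF hmeas hui hη

end UniformFatou

/-- Uniform dominated convergence theorem for variable measures. -/
theorem uniform_fatou_stmt11 {S : Type*} [MeasurableSpace S]
    (μs : ℕ → Measure S) (μ : Measure S) [∀ n, IsFiniteMeasure (μs n)]
    (htv : Tendsto (fun n => ⨆ (A : Set S) (_ : MeasurableSet A),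
      (μs n A - μ A) + (μ A - μs n A)) atTop (𝓝 0))
    (f : S → ℝ) (F : ℕ → S → ℝ)
    (hf : Integrable f μ) (hF : ∀ n, Integrable (F n) (μs n)) :
    Tendsto (fun n => ⨆ (A : Set S) (_ : MeasurableSet A),
        |∫ s in A, F n s ∂(μs n) - ∫ s in A, f s ∂μ|) atTop (𝓝 0) ↔
    ((∀ ε : ℝ, 0 < ε →
        Tendsto (fun n => μ {s | ε ≤ |F n s - f s|}) atTop (𝓝 0)) ∧
      (∀ ε : ℝ, 0 < ε → ∃ K₀ : ℝ, ∀ K ≥ K₀, ∀ n,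
        ∫ s in {x | K ≤ |F n x|}, |F n s| ∂(μs n) ≤ ε)) := by
  have := UniformFatou.isFiniteMeasure_of_tendsto htv
  rw [UniformFatou.tendsto_iSup_measurableSet_iff (fun _ _ => abs_nonneg _) fun n =>
    ⟨_, UniformFatou.abs_setIntegral_sub_setIntegral_le_add hf (hF n)⟩]
  obtain ⟨g, hgm, hfg⟩ := hf.aestronglyMeasurable
  choose G hGm hFG using fun n => (hF n).aestronglyMeasurable
  have hne : Tendsto (fun n => μ {s | F n s ≠ G n s}) atTop (𝓝 0) :=
    UniformFatou.tendsto_measure_zero_of_null htv hFG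
  have hmeas : ∀ ε : ℝ, Tendsto (fun n => μ {s | ε ≤ |F n s - f s|}) atTop (𝓝 0) ↔
      Tendsto (fun n => μ {s | ε ≤ |G n s - g s|}) atTop (𝓝 0) := fun ε =>
    ⟨UniformFatou.tendsto_measure_abs_sub_congr hfg hne,
      UniformFatou.tendsto_measure_abs_sub_congr hfg.symm (by simpa only [ne_comm] using hne)⟩
  have hint : ∀ n A, ∫ s in A, F n s ∂(μs n) = ∫ s in A, G n s ∂(μs n) := fun n A =>
    integral_congr_ae (ae_restrict_of_ae (hFG n))
  have hint' : ∀ A, ∫ s in A, f s ∂μ = ∫ s in A, g s ∂μ := fun A =>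
    integral_congr_ae (ae_restrict_of_ae hfg)
  simp only [hmeas, hint, hint', UniformFatou.setIntegral_abs_tail_congr (hFG _),
    ← eventually_atTop]
  exact UniformFatou.uniform_iff_of_measurable
    (fun δ hδ => UniformFatou.eventually_abs_measureReal_sub_le htv hδ) hgm.measurable
    (hf.congr hfg) (fun n => (hGm n).measurable) fun n => (hF n).congr (hFG n)
end

section
/- Let $(S,\Sigma)$ be a measurable space, $\{\mu^{(n)}\}$ finite measures converging in total variation to $\mu$, $f \in L^1(S;\mu)$, and $f^{(n)} \in L^1(S;\mu^{(n)})$ a uniformly bounded sequence (i.e., $\sup_n \sup_s |f^{(n)}(s)| < \infty$). If $f^{(n)} \to f$ in measure $\mu$, then $\lim_{n\to\infty}\sup_{A\in\Sigma}|\int_A f^{(n)}\,d\mu^{(n)} - \int_A f\,d\mu| = 0$. -/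
open MeasureTheory Filter Topology

/-- The integrals of a measurable function with values in `[0, M]` against two finite measures that
differ by at most `δ` on measurable sets differ by at most `δ * M`. -/
lemma abs_integral_sub_integral_le_of_nonneg {S : Type*} [MeasurableSpace S]
    {ν₁ ν₂ : Measure S} [IsFiniteMeasure ν₁] [IsFiniteMeasure ν₂] {δ M : ℝ} {h : S → ℝ}
    (hδ : ∀ A, MeasurableSet A → |ν₁.real A - ν₂.real A| ≤ δ)
    (hm : Measurable h) (h0 : ∀ s, 0 ≤ h s) (hM : ∀ s, h s ≤ M) (M0 : 0 ≤ M) :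
    |∫ s, h s ∂ν₁ - ∫ s, h s ∂ν₂| ≤ δ * M := by
  have hint (ν : Measure S) [IsFiniteMeasure ν] : Integrable h ν :=
    .of_bound hm.aestronglyMeasurable M (.of_forall fun s => by
      rw [Real.norm_eq_abs, abs_of_nonneg (h0 s)]; exact hM s)
  have hlevel (ν : Measure S) [IsFiniteMeasure ν] :
      IntegrableOn (fun t => ν.real {a | t ≤ h a}) (Set.Ioc 0 M) := by
    refine (AntitoneOn.integrableOn_isCompact isCompact_Icc ?_).mono_set Set.Ioc_subset_Icc_self
    intro s _ t _ hst
    exact measureReal_mono fun a (ha : t ≤ h a) => hst.trans ha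
  rw [(hint ν₁).integral_eq_integral_Ioc_meas_le (.of_forall h0) (.of_forall hM),
    (hint ν₂).integral_eq_integral_Ioc_meas_le (.of_forall h0) (.of_forall hM),
    ← integral_sub (hlevel ν₁) (hlevel ν₂)]
  have hconst := norm_setIntegral_le_of_norm_le_const (μ := volume) (s := Set.Ioc 0 M) (C := δ)
    (f := fun t => ν₁.real {a | t ≤ h a} - ν₂.real {a | t ≤ h a})
    measure_Ioc_lt_top fun t _ => hδ _ (measurableSet_le measurable_const hm)
  simpa [M0] using hconst

lemma abs_integral_sub_integral_le {S : Type*} [MeasurableSpace S]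
    {ν₁ ν₂ : Measure S} [IsFiniteMeasure ν₁] [IsFiniteMeasure ν₂] {δ C : ℝ} {h : S → ℝ}
    (hδ : ∀ A, MeasurableSet A → |ν₁.real A - ν₂.real A| ≤ δ)
    (hm : Measurable h) (hC : ∀ s, |h s| ≤ C) (C0 : 0 ≤ C) :
    |∫ s, h s ∂ν₁ - ∫ s, h s ∂ν₂| ≤ 3 * C * δ := by
  have hshift (ν : Measure S) [IsFiniteMeasure ν] :
      ∫ s, h s + C ∂ν = ∫ s, h s ∂ν + ν.real Set.univ * C := by
    rw [integral_add (.of_bound hm.aestronglyMeasurable C (.of_forall hC)) (integrable_const C)]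
    simp
  have key := abs_integral_sub_integral_le_of_nonneg (M := 2 * C) hδ (hm.add_const C)
    (fun s => by linarith [(abs_le.1 (hC s)).1]) (fun s => by linarith [(abs_le.1 (hC s)).2])
    (by positivity)
  rw [hshift, hshift] at key
  have huniv := hδ _ MeasurableSet.univ
  rw [abs_le] at key huniv ⊢
  constructor <;> nlinarith

lemma abs_setIntegral_sub_setIntegral_le {S : Type*} [MeasurableSpace S]
    {ν₁ ν₂ : Measure S} [IsFiniteMeasure ν₁] [IsFiniteMeasure ν₂] {δ C : ℝ} {h : S → ℝ}
    (hδ : ∀ A, MeasurableSet A → |ν₁.real A - ν₂.real A| ≤ δ)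
    (hm : Measurable h) (hC : ∀ s, |h s| ≤ C) (C0 : 0 ≤ C) {A : Set S} (hA : MeasurableSet A) :
    |∫ s in A, h s ∂ν₁ - ∫ s in A, h s ∂ν₂| ≤ 3 * C * δ := by
  refine abs_integral_sub_integral_le (fun B hB => ?_) hm hC C0
  simpa [measureReal_restrict_apply hB] using hδ _ (hB.inter hA)

/-- A uniformly bounded sequence converging in measure, for a finite measure, converges in `L¹`. -/
lemma tendsto_integral_abs_sub_of_bounded {S : Type*} [MeasurableSpace S]
    {μ : Measure S} [IsFiniteMeasure μ] {G : ℕ → S → ℝ} {f : S → ℝ} {C : ℝ}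
    (hG : ∀ n, Measurable (G n)) (hC : ∀ n s, |G n s| ≤ C) (C0 : 0 ≤ C) (hf : Integrable f μ)
    (hGf : TendstoInMeasure μ G atTop f) :
    Tendsto (fun n => ∫ s, |G n s - f s| ∂μ) atTop (𝓝 0) := by
  have hui : UnifIntegrable G 1 μ := by
    refine unifIntegrable_of le_rfl ENNReal.one_ne_top
      (fun n => (hG n).aestronglyMeasurable) fun ε _ => ⟨⟨C, C0⟩ + 1, fun n => ?_⟩
    have hempty : {x | (⟨C, C0⟩ + 1 : NNReal) ≤ ‖G n x‖₊} = ∅ := by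
      refine Set.eq_empty_of_forall_notMem fun x hx => ?_
      have hx' : C + 1 ≤ |G n x| := hx
      linarith [hC n x]
    rw [hempty]
    simp
  have hlim := tendsto_Lp_finite_of_tendstoInMeasure le_rfl ENNReal.one_ne_top
    (fun n => (hG n).aestronglyMeasurable) (memLp_one_iff_integrable.2 hf) hui hGf
  have hreal := (ENNReal.tendsto_toReal ENNReal.zero_ne_top).comp hlim
  refine hreal.congr fun n => ?_
  rw [Function.comp_apply, eLpNorm_one_eq_lintegral_enorm,
    ← integral_norm_eq_lintegral_enorm ((hG n).aestronglyMeasurable.sub hf.aestronglyMeasurable)]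
  rfl

/-- For uniformly bounded functions, convergence in measure `μ` together with convergence
of the measures in total variation implies the uniform convergence of integrals. -/
theorem uniform_fatou_stmt12 {S : Type*} [MeasurableSpace S]
    (μs : ℕ → Measure S) (μ : Measure S) [∀ n, IsFiniteMeasure (μs n)]
    (htv : Tendsto (fun n => ⨆ (A : Set S) (_ : MeasurableSet A),
      (μs n A - μ A) + (μ A - μs n A)) atTop (𝓝 0))
    (f : S → ℝ) (F : ℕ → S → ℝ)
    (hf : Integrable f μ) (hF : ∀ n, Integrable (F n) (μs n))
    (hbdd : ∃ C : ℝ, ∀ n s, |F n s| ≤ C)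
    (hmeas : ∀ ε : ℝ, 0 < ε →
      Tendsto (fun n => μ {s | ε ≤ |F n s - f s|}) atTop (𝓝 0)) :
    Tendsto (fun n => ⨆ (A : Set S) (_ : MeasurableSet A),
      |∫ s in A, F n s ∂(μs n) - ∫ s in A, f s ∂μ|) atTop (𝓝 0) := by
  obtain ⟨C', hC'⟩ := hbdd
  obtain ⟨C, C0, hC⟩ : ∃ C : ℝ, 0 ≤ C ∧ ∀ n s, |F n s| ≤ C :=
    ⟨|C'|, abs_nonneg _, fun n s => (hC' n s).trans (le_abs_self _)⟩
  set d : ℕ → ENNReal := fun n => ⨆ (A : Set S) (_ : MeasurableSet A),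
    (μs n A - μ A) + (μ A - μs n A)
  have hle (n : ℕ) {A : Set S} (hA : MeasurableSet A) :
      (μs n A - μ A) + (μ A - μs n A) ≤ d n :=
    le_iSup₂ (f := fun (A : Set S) (_ : MeasurableSet A) =>
      (μs n A - μ A) + (μ A - μs n A)) A hA
  have hdtop : ∀ᶠ n in atTop, d n < ⊤ := htv.eventually (gt_mem_nhds ENNReal.zero_lt_top)
  have hμs (n : ℕ) {A : Set S} (hA : MeasurableSet A) : μs n A ≤ μ A + d n :=
    tsub_le_iff_left.1 (le_self_add.trans (hle n hA))
  have hμ (n : ℕ) {A : Set S} (hA : MeasurableSet A) : μ A ≤ μs n A + d n :=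
    tsub_le_iff_left.1 (le_add_self.trans (hle n hA))
  have : IsFiniteMeasure μ := by
    obtain ⟨n, hn⟩ := hdtop.exists
    exact ⟨(hμ n .univ).trans_lt (ENNReal.add_lt_top.2 ⟨measure_lt_top _ _, hn⟩)⟩
  have hreal : ∀ᶠ n in atTop, ∀ A, MeasurableSet A →
      |(μs n).real A - μ.real A| ≤ (d n).toReal := by
    filter_upwards [hdtop] with n hn A hA
    have h₁ := ENNReal.toReal_mono (by finiteness) (hμs n hA)
    have h₂ := ENNReal.toReal_mono (by finiteness) (hμ n hA)
    rw [ENNReal.toReal_add (by finiteness) hn.ne] at h₁ h₂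
    rw [measureReal_def, measureReal_def, abs_le]
    constructor <;> linarith
  -- `F n` need not be `μ`-measurable: replace it by a measurable, still bounded, representative.
  have hrep (n : ℕ) : ∃ g : S → ℝ, Measurable g ∧ (∀ s, |g s| ≤ C) ∧ F n =ᵐ[μs n] g := by
    obtain ⟨g, hg, hFg⟩ := (hF n).aestronglyMeasurable
    refine ⟨fun s => max (-C) (min C (g s)),
      measurable_const.max (measurable_const.min hg.measurable), fun s => ?_, ?_⟩
    · exact abs_le.2 ⟨le_max_left _ _, max_le (by linarith) (min_le_left _ _)⟩
    · filter_upwards [hFg] with s hs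
      have := abs_le.1 (hC n s)
      rw [← hs, min_eq_right this.2, max_eq_right this.1]
  choose G hGm hGC hFG using hrep
  have hGf : TendstoInMeasure μ G atTop f := by
    rw [tendstoInMeasure_iff_norm]
    intro ε hε
    have hsum := (hmeas ε hε).add htv
    rw [add_zero] at hsum
    refine tendsto_of_tendsto_of_tendsto_of_le_of_le tendsto_const_nhds hsum
      (fun _ => zero_le) fun n => ?_
    obtain ⟨N, hN, hNm, hN0⟩ := exists_measurable_superset_of_null (ae_iff.1 (hFG n))
    have hsub : {s | ε ≤ ‖G n s - f s‖} ⊆ {s | ε ≤ |F n s - f s|} ∪ N := by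
      intro s hs
      by_cases hFs : F n s = G n s
      · left
        simpa [hFs] using hs
      · exact .inr (hN hFs)
    calc μ {s | ε ≤ ‖G n s - f s‖} ≤ μ {s | ε ≤ |F n s - f s|} + μ N :=
          (measure_mono hsub).trans (measure_union_le _ _)
      _ ≤ μ {s | ε ≤ |F n s - f s|} + d n := by
          gcongr
          simpa [hN0] using hμ n hNm
  have hL1 := tendsto_integral_abs_sub_of_bounded hGm hGC C0 hf hGf
  have hbound : Tendsto (fun n => 3 * C * (d n).toReal + ∫ s, |G n s - f s| ∂μ) atTop (𝓝 0) := by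
    have hd0 := (ENNReal.tendsto_toReal ENNReal.zero_ne_top).comp htv
    simpa using (hd0.const_mul (3 * C)).add hL1
  refine tendsto_of_tendsto_of_tendsto_of_le_of_le' tendsto_const_nhds hbound
    (.of_forall fun n => Real.iSup_nonneg fun A => Real.iSup_nonneg fun _ => abs_nonneg _) ?_
  filter_upwards [hreal] with n hn
  have hnonneg : 0 ≤ 3 * C * (d n).toReal + ∫ s, |G n s - f s| ∂μ := by positivity
  refine Real.iSup_le (fun A => Real.iSup_le (fun hA => ?_) hnonneg) hnonneg
  have hGint : Integrable (G n) μ :=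
    .of_bound (hGm n).aestronglyMeasurable C (.of_forall (hGC n))
  have hdiff : |∫ s in A, G n s ∂μ - ∫ s in A, f s ∂μ| ≤ ∫ s, |G n s - f s| ∂μ := by
    rw [← integral_sub hGint.integrableOn hf.integrableOn]
    exact abs_integral_le_integral_abs.trans
      (setIntegral_le_integral (hGint.sub hf).abs (.of_forall fun _ => abs_nonneg _))
  rw [integral_congr_ae (ae_restrict_of_ae (hFG n))]
  exact (abs_sub_le _ (∫ s in A, G n s ∂μ) _).trans
    (add_le_add (abs_setIntegral_sub_setIntegral_le hn (hGm n) (hGC n) C0 hA) hdiff)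
end
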